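/- arXiv:1403.1088 — 7 statements merged into one kernel-verified Lean document; each statement's English description precedes it below -/
import Mathlib

section
/- Let H₁ and H₂ be two closed subspaces of a real Hilbert space H with inner product ⟨·,·⟩ and norm ‖·‖, and let 0 ≤ ρ < 1 be a real constant. Then the following three assertions are equivalent: (i) |⟨h₁, h₂⟩| ≤ ρ‖h₁‖‖h₂‖ for all nonzero h₁ ∈ H₁ and nonzero h₂ ∈ H₂; (ii) ‖h₁ + h₂‖² ≥ (1 − ρ)(‖h₁‖² + ‖h₂‖²) for all h₁ ∈ H₁ and h₂ ∈ H₂; (iii) ‖h₁ + h₂‖² ≥ (1 − ρ²)‖h₁‖² for all h₁ ∈ H₁ and h₂ ∈ H₂. -/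
open scoped RealInnerProductSpace

/-- Lemma 2 of the paper: equivalence of three formulations of the minimal-angle condition. -/
theorem stmt0 {H : Type*} [NormedAddCommGroup H] [InnerProductSpace ℝ H] [CompleteSpace H]
    (H₁ H₂ : Submodule ℝ H) (hc₁ : IsClosed (H₁ : Set H)) (hc₂ : IsClosed (H₂ : Set H))
    (ρ : ℝ) (hρ0 : 0 ≤ ρ) (hρ1 : ρ < 1) :
    List.TFAE
      [∀ h₁ ∈ H₁, ∀ h₂ ∈ H₂, h₁ ≠ 0 → h₂ ≠ 0 → |⟪h₁, h₂⟫| ≤ ρ * (‖h₁‖ * ‖h₂‖),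
       ∀ h₁ ∈ H₁, ∀ h₂ ∈ H₂, (1 - ρ) * (‖h₁‖ ^ 2 + ‖h₂‖ ^ 2) ≤ ‖h₁ + h₂‖ ^ 2,
       ∀ h₁ ∈ H₁, ∀ h₂ ∈ H₂, (1 - ρ ^ 2) * ‖h₁‖ ^ 2 ≤ ‖h₁ + h₂‖ ^ 2] := by
  have cauchy_of_angle
      (h : ∀ h₁ ∈ H₁, ∀ h₂ ∈ H₂, h₁ ≠ 0 → h₂ ≠ 0 → |⟪h₁, h₂⟫| ≤ ρ * (‖h₁‖ * ‖h₂‖)) :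
      ∀ h₁ ∈ H₁, ∀ h₂ ∈ H₂, -(ρ * (‖h₁‖ * ‖h₂‖)) ≤ ⟪h₁, h₂⟫ := by
    intro x hx y hy
    by_cases hx0 : x = 0
    · simp [hx0]
    by_cases hy0 : y = 0
    · simp [hy0]
    exact (abs_le.mp (h x hx y hy hx0 hy0)).1
  tfae_have 1 → 2 := by
    intro h x hx y hy
    have hxy := cauchy_of_angle h x hx y hy
    rw [norm_add_sq_real]
    nlinarith [mul_nonneg hρ0 (sq_nonneg (‖x‖ - ‖y‖))]
  tfae_have 1 → 3 := by
    intro h x hx y hy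
    have hxy := cauchy_of_angle h x hx y hy
    rw [norm_add_sq_real]
    nlinarith [sq_nonneg (ρ * ‖x‖ - ‖y‖)]
  tfae_have 2 → 1 := by
    intro h x hx y hy hx0 hy0
    have hpos : 0 < ‖x‖ * ‖y‖ := mul_pos (norm_pos_iff.mpr hx0) (norm_pos_iff.mpr hy0)
    have hadd := h _ (H₁.smul_mem ‖y‖ hx) _ (H₂.smul_mem ‖x‖ hy)
    have hsub := h _ (H₁.smul_mem ‖y‖ hx) _ (H₂.smul_mem (-‖x‖) hy)
    simp only [norm_add_sq_real, norm_smul, real_inner_smul_left, real_inner_smul_right,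
      norm_neg, norm_norm] at hadd hsub
    rw [abs_le]
    constructor <;> refine le_of_mul_le_mul_left ?_ hpos <;> linarith
  tfae_have 3 → 1 := by
    intro h x hx y hy hx0 hy0
    have hpos : 0 < ‖y‖ ^ 2 := pow_pos (norm_pos_iff.mpr hy0) 2
    have hproj := h _ (H₁.smul_mem (‖y‖ ^ 2) hx) _ (H₂.smul_mem (-⟪x, y⟫) hy)
    simp only [norm_add_sq_real, norm_smul, real_inner_smul_left, real_inner_smul_right,
      mul_pow, Real.norm_eq_abs, sq_abs, neg_sq] at hproj
    refine abs_le_of_sq_le_sq ?_ (by positivity)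
    refine le_of_mul_le_mul_left ?_ hpos
    linarith
  tfae_finish
end

section
/- Let H₁ and H₂ be closed subspaces of a real Hilbert space H with ρ₀(H₁, H₂) < 1, so that H₁ + H₂ is closed and every element of H₁ + H₂ decomposes uniquely as a sum of an element of H₁ and an element of H₂. Let Π, Π₁, Π₂ denote the orthogonal projections onto H₁ + H₂, H₁, H₂ respectively. For h ∈ H, write Πh = (Πh)₁ + (Πh)₂ with (Πh)₁ ∈ H₁ and (Πh)₂ ∈ H₂. Then ‖(Πh)₁ − (Π₁ − Σ_{j=1}^{k} (Π₁Π₂)^j (I − Π₁)) h‖ → 0 as k → ∞. -/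
open scoped RealInnerProductSpace

/-- The cosine of the minimal angle between two subspaces of a real inner product space. -/
noncomputable def rho0 {H : Type*} [NormedAddCommGroup H] [InnerProductSpace ℝ H]
    (H₁ H₂ : Submodule ℝ H) : ℝ :=
  sSup {r : ℝ | ∃ h₁ ∈ H₁, ∃ h₂ ∈ H₂, h₁ ≠ 0 ∧ h₂ ≠ 0 ∧ r = ⟪h₁, h₂⟫ / (‖h₁‖ * ‖h₂‖)}

theorem inner_le_rho0_mul {H : Type*} [NormedAddCommGroup H] [InnerProductSpace ℝ H]
    {H₁ H₂ : Submodule ℝ H} {a b : H} (ha : a ∈ H₁) (hb : b ∈ H₂) :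
    ⟪a, b⟫ ≤ rho0 H₁ H₂ * (‖a‖ * ‖b‖) := by
  by_cases ha0 : a = 0
  · simp [ha0]
  by_cases hb0 : b = 0
  · simp [hb0]
  have hpos : 0 < ‖a‖ * ‖b‖ := mul_pos (norm_pos_iff.2 ha0) (norm_pos_iff.2 hb0)
  rw [← div_le_iff₀ hpos]
  refine le_csSup ⟨1, ?_⟩ ⟨a, ha, b, hb, ha0, hb0, rfl⟩
  rintro r ⟨x, -, y, -, -, -, rfl⟩
  exact div_le_one_of_le₀ (real_inner_le_norm x y) (by positivity)

theorem norm_starProjection_comp_le_rho0 {H : Type*} [NormedAddCommGroup H]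
    [InnerProductSpace ℝ H] (H₁ H₂ : Submodule ℝ H) [H₁.HasOrthogonalProjection]
    [H₂.HasOrthogonalProjection] :
    ‖H₁.starProjection ∘L H₂.starProjection‖ ≤ max (rho0 H₁ H₂) 0 := by
  refine ContinuousLinearMap.opNorm_le_bound _ (le_max_right _ _) fun x => ?_
  rw [ContinuousLinearMap.comp_apply]
  set b := H₂.starProjection x with hb
  set a := H₁.starProjection b with ha
  have hbx : ‖b‖ ≤ ‖x‖ := H₂.norm_starProjection_apply_le x
  have hsq : ‖a‖ * ‖a‖ = ⟪a, b⟫ := by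
    have h0 : ⟪b - a, a⟫ = 0 :=
      H₁.starProjection_inner_eq_zero b a (H₁.starProjection_apply_mem b)
    rw [inner_sub_left, real_inner_self_eq_norm_mul_norm, real_inner_comm] at h0
    linarith
  have hle : ‖a‖ * ‖a‖ ≤ max (rho0 H₁ H₂) 0 * ‖x‖ * ‖a‖ := calc
    ‖a‖ * ‖a‖ ≤ rho0 H₁ H₂ * (‖a‖ * ‖b‖) := hsq ▸
      inner_le_rho0_mul (H₁.starProjection_apply_mem b) (H₂.starProjection_apply_mem x)
    _ ≤ max (rho0 H₁ H₂) 0 * (‖a‖ * ‖x‖) := by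
      gcongr
      exact le_max_left _ _
    _ = max (rho0 H₁ H₂) 0 * ‖x‖ * ‖a‖ := by ring
  rcases (norm_nonneg a).eq_or_lt with h0 | h0
  · rw [← h0]
    positivity
  · exact le_of_mul_le_mul_right hle h0

theorem sum_Icc_pow_apply_telescope {R M : Type*} [Ring R] [AddCommGroup M] [Module R M]
    (T : M →ₗ[R] M) {u v : M} (huv : T u = v - T v) (k : ℕ) :
    ∑ j ∈ Finset.Icc 1 k, (T ^ j) u = v - (T ^ k) v := by
  induction k with
  | zero => simp
  | succ k ih =>
    rw [Finset.sum_Icc_succ_top (by omega), ih, pow_succ, Module.End.mul_apply,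
      Module.End.mul_apply, huv, map_sub]
    abel

/-- Von Neumann-type convergence (Lemma 7 of the paper): if `ρ₀(H₁,H₂) < 1` and
`Πh = g₁ + g₂` is the (unique) decomposition of the projection of `h` onto `H₁ + H₂`, then
`‖g₁ - (Π₁ - Σ_{j=1}^k (Π₁Π₂)^j (I - Π₁)) h‖ → 0` as `k → ∞`.
The orthogonal projections `P`, `P₁`, `P₂` onto `H₁ ⊔ H₂`, `H₁`, `H₂` are characterized by
mapping into the subspace with residual in its orthogonal complement. -/
theorem stmt2 {H : Type*} [NormedAddCommGroup H] [InnerProductSpace ℝ H] [CompleteSpace H]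
    (H₁ H₂ : Submodule ℝ H) (hc₁ : IsClosed (H₁ : Set H)) (hc₂ : IsClosed (H₂ : Set H))
    (hρ : rho0 H₁ H₂ < 1)
    (P P₁ P₂ : H →L[ℝ] H)
    (hP : ∀ x : H, P x ∈ H₁ ⊔ H₂ ∧ x - P x ∈ (H₁ ⊔ H₂ : Submodule ℝ H)ᗮ)
    (hP₁ : ∀ x : H, P₁ x ∈ H₁ ∧ x - P₁ x ∈ H₁ᗮ)
    (hP₂ : ∀ x : H, P₂ x ∈ H₂ ∧ x - P₂ x ∈ H₂ᗮ)
    (h g₁ g₂ : H) (hg₁ : g₁ ∈ H₁) (hg₂ : g₂ ∈ H₂) (hdec : P h = g₁ + g₂) :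
    Filter.Tendsto
      (fun k : ℕ => ‖g₁ - (P₁ h - ∑ j ∈ Finset.Icc 1 k, ((P₁ ∘L P₂) ^ j) (h - P₁ h))‖)
      Filter.atTop (nhds 0) := by
  have := hc₁.completeSpace_coe
  have := hc₂.completeSpace_coe
  obtain rfl : P₁ = H₁.starProjection := by
    ext x
    exact (Submodule.eq_starProjection_of_mem_orthogonal (hP₁ x).1 (hP₁ x).2).symm
  obtain rfl : P₂ = H₂.starProjection := by
    ext x
    exact (Submodule.eq_starProjection_of_mem_orthogonal (hP₂ x).1 (hP₂ x).2).symm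
  have hres : h - (g₁ + g₂) ∈ (H₁ ⊔ H₂)ᗮ := hdec ▸ (hP h).2
  have h₁ : H₁.starProjection h = g₁ + H₁.starProjection g₂ := by
    have h0 := (Submodule.starProjection_apply_eq_zero_iff H₁).2
      (Submodule.orthogonal_le le_sup_left hres)
    rw [map_sub, map_add, Submodule.starProjection_eq_self_iff.2 hg₁] at h0
    exact sub_eq_zero.1 h0
  have h₂ : H₂.starProjection h = H₂.starProjection g₁ + g₂ := by
    have h0 := (Submodule.starProjection_apply_eq_zero_iff H₂).2
      (Submodule.orthogonal_le le_sup_right hres)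
    rw [map_sub, map_add, Submodule.starProjection_eq_self_iff.2 hg₂] at h0
    exact sub_eq_zero.1 h0
  set T := H₁.starProjection ∘L H₂.starProjection with hT
  set v := H₁.starProjection g₂ with hv
  have hTu : T (h - H₁.starProjection h) = v - T v := by
    simp only [hT, ContinuousLinearMap.comp_apply, map_sub, h₁, h₂, map_add]
    rw [hv]
    abel
  have hsum (k : ℕ) :
      ∑ j ∈ Finset.Icc 1 k, (T ^ j) (h - H₁.starProjection h) = v - (T ^ k) v := by
    have := sum_Icc_pow_apply_telescope (T : H →ₗ[ℝ] H) hTu k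
    simpa only [← ContinuousLinearMap.toLinearMap_pow, ContinuousLinearMap.coe_coe] using this
  have hTlt : ‖T‖ < 1 :=
    (norm_starProjection_comp_le_rho0 H₁ H₂).trans_lt (max_lt hρ one_pos)
  have hlim : Filter.Tendsto (fun k : ℕ => ‖(T ^ k) v‖) Filter.atTop (nhds 0) := by
    have hpow := tendsto_pow_atTop_nhds_zero_of_norm_lt_one hTlt
    simpa using ((ContinuousLinearMap.apply ℝ H v).continuous.tendsto 0 |>.comp hpow).norm
  refine hlim.congr fun k => ?_
  rw [hsum, h₁, ← norm_neg]
  congr 1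
  abel
end

section
/- Let H₁ and H₂ be closed subspaces of a real Hilbert space H and let 0 ≤ ρ ≤ 1. Suppose that |⟨h₁, h₂⟩| ≤ ρ‖h₁‖‖h₂‖ for all h₁ ∈ H₁ and h₂ ∈ H₂. Let Π₁ and Π₂ denote the orthogonal projections onto H₁ and H₂. Then ‖Π₂ Π₁ Π₂ h‖ ≤ ρ² ‖h‖ for every h ∈ H; that is, the operator norm of Π₂Π₁Π₂ is at most ρ². -/
open scoped RealInnerProductSpace

/-- If `y` is the orthogonal projection of `x` onto `K` and the cosine of the angle between `y` and
`x` is at most `ρ`, then `‖y‖ ≤ ρ * ‖x‖`. -/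
theorem norm_le_mul_norm_of_sub_mem_orthogonal {E : Type*} [NormedAddCommGroup E]
    [InnerProductSpace ℝ E] {K : Submodule ℝ E} {x y : E} {ρ : ℝ} (hρ : 0 ≤ ρ) (hy : y ∈ K)
    (hxy : x - y ∈ Kᗮ) (hle : ⟪y, x⟫ ≤ ρ * (‖y‖ * ‖x‖)) : ‖y‖ ≤ ρ * ‖x‖ := by
  have horth : ⟪y, x - y⟫ = 0 := K.inner_right_of_mem_orthogonal hy hxy
  rw [inner_sub_right, real_inner_self_eq_norm_sq, sub_eq_zero] at horth
  rcases (norm_nonneg y).eq_or_lt with h0 | hpos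
  · rw [← h0]
    positivity
  · refine le_of_mul_le_mul_left ?_ hpos
    linarith

/-- If `|⟨h₁, h₂⟩| ≤ ρ‖h₁‖‖h₂‖` for all `h₁ ∈ H₁`, `h₂ ∈ H₂`, then the operator
`Π₂Π₁Π₂` built from the orthogonal projections onto `H₁` and `H₂` satisfies
`‖Π₂Π₁Π₂ h‖ ≤ ρ²‖h‖` for every `h ∈ H`, i.e. its operator norm is at most `ρ²`. -/
theorem stmt6 {H : Type*} [NormedAddCommGroup H] [InnerProductSpace ℝ H] [CompleteSpace H]
    (H₁ H₂ : Submodule ℝ H) (hc₁ : IsClosed (H₁ : Set H)) (hc₂ : IsClosed (H₂ : Set H))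
    (ρ : ℝ) (hρ0 : 0 ≤ ρ) (hρ1 : ρ ≤ 1)
    (hang : ∀ h₁ ∈ H₁, ∀ h₂ ∈ H₂, |⟪h₁, h₂⟫| ≤ ρ * (‖h₁‖ * ‖h₂‖))
    (P₁ P₂ : H →L[ℝ] H)
    (hP₁ : ∀ x : H, P₁ x ∈ H₁ ∧ x - P₁ x ∈ H₁ᗮ)
    (hP₂ : ∀ x : H, P₂ x ∈ H₂ ∧ x - P₂ x ∈ H₂ᗮ)
    (h : H) :
    ‖P₂ (P₁ (P₂ h))‖ ≤ ρ ^ 2 * ‖h‖ := by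
  have hproj : ‖P₂ h‖ ≤ 1 * ‖h‖ :=
    norm_le_mul_norm_of_sub_mem_orthogonal zero_le_one (hP₂ h).1 (hP₂ h).2
      (by simpa using real_inner_le_norm (P₂ h) h)
  have h₁₂ : ‖P₁ (P₂ h)‖ ≤ ρ * ‖P₂ h‖ :=
    norm_le_mul_norm_of_sub_mem_orthogonal hρ0 (hP₁ _).1 (hP₁ _).2
      ((le_abs_self _).trans (hang _ (hP₁ _).1 _ (hP₂ h).1))
  have h₂₁ : ‖P₂ (P₁ (P₂ h))‖ ≤ ρ * ‖P₁ (P₂ h)‖ := by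
    refine norm_le_mul_norm_of_sub_mem_orthogonal hρ0 (hP₂ _).1 (hP₂ _).2 ?_
    rw [real_inner_comm, mul_comm ‖P₂ _‖]
    exact (le_abs_self _).trans (hang _ (hP₁ _).1 _ (hP₂ _).1)
  calc ‖P₂ (P₁ (P₂ h))‖ ≤ ρ * (ρ * (1 * ‖h‖)) := h₂₁.trans (by gcongr; exact h₁₂.trans (by gcongr))
    _ = ρ ^ 2 * ‖h‖ := by ring
end

section
/- Let V₁ and V₂ be subspaces of a real vector space equipped with two inner products ⟨·,·⟩ and ⟨·,·⟩_n, with associated norms ‖·‖ and ‖·‖_n. Let 0 < δ < 1 and 0 ≤ ρ₀ < 1 be constants. Suppose that (1 − δ)‖g‖² ≤ ‖g‖_n² ≤ (1 + δ)‖g‖² for all g ∈ V₁ + V₂, and that |⟨g₁, g₂⟩| ≤ ρ₀‖g₁‖‖g₂‖ for all g₁ ∈ V₁ and g₂ ∈ V₂. Then for all g₁ ∈ V₁ and g₂ ∈ V₂: (a) ‖g₁ + g₂‖_n² ≥ ((1 − δ)/(1 + δ))(1 − ρ₀)(‖g₁‖_n² + ‖g₂‖_n²); (b) ‖g₁ +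 g₂‖_n² ≥ ((1 − δ)/(1 + δ))(1 − ρ₀²)‖g₁‖_n²; and (c) for all nonzero g₁ ∈ V₁ and nonzero g₂ ∈ V₂, |⟨g₁, g₂⟩_n| ≤ (1 − ((1 − δ)/(1 + δ))(1 − ρ₀)) ‖g₁‖_n ‖g₂‖_n. -/
open scoped RealInnerProductSpace

/-- A quadratic lower bound `k * q ≤ p` is transferred through the two-sided comparisons
`(1 - δ) * p ≤ P` and `Q ≤ (1 + δ) * q`, at the price of the factor `(1 - δ) / (1 + δ)`. -/
theorem ratio_mul_mul_le_of_le {δ k p q P Q : ℝ} (hδ0 : 0 < δ) (hδ1 : δ < 1) (hk : 0 ≤ k)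
    (hkq : k * q ≤ p) (hP : (1 - δ) * p ≤ P) (hQ : Q ≤ (1 + δ) * q) :
    (1 - δ) / (1 + δ) * k * Q ≤ P := by
  have hpos : 0 < 1 + δ := by linarith
  have hc : 0 ≤ (1 - δ) / (1 + δ) * k :=
    mul_nonneg (div_nonneg (by linarith) hpos.le) hk
  calc (1 - δ) / (1 + δ) * k * Q ≤ (1 - δ) / (1 + δ) * k * ((1 + δ) * q) :=
        mul_le_mul_of_nonneg_left hQ hc
    _ = (1 - δ) * (k * q) := by field_simp
    _ ≤ (1 - δ) * p := mul_le_mul_of_nonneg_left hkq (by linarith)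
    _ ≤ P := hP

/-- A lower bound on `B (x + y) (x + y)` over two subspaces on which `B` is positive gives a
bound on the cosine of the angle between them with respect to `B`. -/
theorem abs_apply_le_of_mul_add_le {E : Type*} [AddCommGroup E] [Module ℝ E]
    {V₁ V₂ : Submodule ℝ E} {B : E →ₗ[ℝ] E →ₗ[ℝ] ℝ} (hBsymm : ∀ x y : E, B x y = B y x) {c : ℝ}
    (h : ∀ x ∈ V₁, ∀ y ∈ V₂, c * (B x x + B y y) ≤ B (x + y) (x + y))
    {x y : E} (hx : x ∈ V₁) (hy : y ∈ V₂) (hBx : 0 < B x x) (hBy : 0 < B y y) :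
    |B x y| ≤ (1 - c) * (√(B x x) * √(B y y)) := by
  have ha : 0 < √(B x x) := Real.sqrt_pos.2 hBx
  have hb : 0 < √(B y y) := Real.sqrt_pos.2 hBy
  have ha2 : √(B x x) ^ 2 = B x x := Real.sq_sqrt hBx.le
  have hb2 : √(B y y) ^ 2 = B y y := Real.sq_sqrt hBy.le
  have h₁ := h _ (V₁.smul_mem √(B y y) hx) _ (V₂.smul_mem √(B x x) hy)
  have h₂ := h _ (V₁.smul_mem √(B y y) hx) _ (V₂.smul_mem (-√(B x x)) hy)
  simp only [map_add, map_smul, LinearMap.add_apply, LinearMap.smul_apply, smul_eq_mul,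
    hBsymm y x] at h₁ h₂
  generalize √(B x x) = a at *
  generalize √(B y y) = b at *
  rw [← ha2, ← hb2] at h₁ h₂
  have hab : 0 < a * b := mul_pos ha hb
  rw [abs_le]
  constructor <;> refine le_of_mul_le_mul_left ?_ hab <;> linarith

/-- Proposition 1 of the paper (abstract form). `E` carries the inner product `⟪·,·⟫` with
norm `‖·‖`; a second (empirical) inner product is given by the symmetric bilinear form `B`,
with `‖g‖_n² = B g g` and `‖g‖_n = √(B g g)`. Under the norm-equivalence hypothesis on
`V₁ + V₂` and the minimal-angle hypothesis, the three empirical inequalities (a)–(c) hold. -/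
theorem stmt10 {E : Type*} [NormedAddCommGroup E] [InnerProductSpace ℝ E]
    (V₁ V₂ : Submodule ℝ E)
    (B : E →ₗ[ℝ] E →ₗ[ℝ] ℝ) (hBsymm : ∀ x y : E, B x y = B y x)
    (δ ρ₀ : ℝ) (hδ0 : 0 < δ) (hδ1 : δ < 1) (hρ0 : 0 ≤ ρ₀) (hρ1 : ρ₀ < 1)
    (hequiv : ∀ g ∈ V₁ ⊔ V₂, (1 - δ) * ‖g‖ ^ 2 ≤ B g g ∧ B g g ≤ (1 + δ) * ‖g‖ ^ 2)
    (hang : ∀ g₁ ∈ V₁, ∀ g₂ ∈ V₂, |⟪g₁, g₂⟫| ≤ ρ₀ * (‖g₁‖ * ‖g₂‖)) :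
    ∀ g₁ ∈ V₁, ∀ g₂ ∈ V₂,
      ((1 - δ) / (1 + δ)) * (1 - ρ₀) * (B g₁ g₁ + B g₂ g₂) ≤ B (g₁ + g₂) (g₁ + g₂) ∧
      ((1 - δ) / (1 + δ)) * (1 - ρ₀ ^ 2) * B g₁ g₁ ≤ B (g₁ + g₂) (g₁ + g₂) ∧
      (g₁ ≠ 0 → g₂ ≠ 0 →
        |B g₁ g₂| ≤ (1 - ((1 - δ) / (1 + δ)) * (1 - ρ₀)) *
          (Real.sqrt (B g₁ g₁) * Real.sqrt (B g₂ g₂))) := by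
  have hnorm : ∀ g₁ ∈ V₁, ∀ g₂ ∈ V₂,
      ‖g₁‖ ^ 2 + ‖g₂‖ ^ 2 - 2 * (ρ₀ * (‖g₁‖ * ‖g₂‖)) ≤ ‖g₁ + g₂‖ ^ 2 := by
    intro g₁ h₁ g₂ h₂
    have := (abs_le.1 (hang g₁ h₁ g₂ h₂)).1
    rw [norm_add_sq_real]
    linarith
  have hsum : ∀ g₁ ∈ V₁, ∀ g₂ ∈ V₂,
      (1 - δ) / (1 + δ) * (1 - ρ₀) * (B g₁ g₁ + B g₂ g₂) ≤ B (g₁ + g₂) (g₁ + g₂) := by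
    intro g₁ h₁ g₂ h₂
    refine ratio_mul_mul_le_of_le (q := ‖g₁‖ ^ 2 + ‖g₂‖ ^ 2) hδ0 hδ1 (by linarith) ?_
      (hequiv _ (Submodule.add_mem_sup h₁ h₂)).1 ?_
    · nlinarith [hnorm g₁ h₁ g₂ h₂, mul_nonneg hρ0 (sq_nonneg (‖g₁‖ - ‖g₂‖))]
    · linarith [(hequiv _ (Submodule.mem_sup_left h₁)).2,
        (hequiv _ (Submodule.mem_sup_right h₂)).2]
  have hpos : ∀ g ∈ V₁ ⊔ V₂, g ≠ 0 → 0 < B g g := fun g hg hg0 =>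
    (mul_pos (sub_pos.2 hδ1) (pow_pos (norm_pos_iff.2 hg0) 2)).trans_le (hequiv g hg).1
  intro g₁ h₁ g₂ h₂
  refine ⟨hsum g₁ h₁ g₂ h₂, ?_, fun hg₁ hg₂ => ?_⟩
  · refine ratio_mul_mul_le_of_le hδ0 hδ1 (by nlinarith) ?_
      (hequiv _ (Submodule.add_mem_sup h₁ h₂)).1 (hequiv _ (Submodule.mem_sup_left h₁)).2
    nlinarith [hnorm g₁ h₁ g₂ h₂, sq_nonneg (ρ₀ * ‖g₁‖ - ‖g₂‖)]
  · exact abs_apply_le_of_mul_add_le hBsymm hsum h₁ h₂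
      (hpos _ (Submodule.mem_sup_left h₁) hg₁) (hpos _ (Submodule.mem_sup_right h₂) hg₂)
end

section
/- Let E be a finite-dimensional real inner product space, and let P₁, P₂, Q be orthogonal projections on E (self-adjoint idempotent linear maps) such that Q ∘ P₁ = Q (i.e., the range of Q is contained in the range of P₁). Let 0 ≤ ρ ≤ 1 be such that the operator norm of P₂P₁P₂ is at most ρ². Then for every integer j ≥ 1, |tr(Q (P₁P₂)^j Q)| ≤ ρ^{2(j−1)} tr(Q P₂). -/
open scoped RealInnerProductSpace

/-- If `q` is idempotent then `(pq)^(k+1) = pq(qpq)^k q`. -/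
theorem mul_pow_succ_eq_of_mul_self_eq {M : Type*} [Monoid M] {p q : M} (hq : q * q = q)
    (k : ℕ) : (p * q) ^ (k + 1) = p * q * (q * (p * q)) ^ k * q := by
  have hleft : p * q * (q * (p * q)) = p * q * (p * q) := by
    rw [← mul_assoc (p * q) q, mul_assoc p q q, hq]
  have hpow : p * q * (q * (p * q)) ^ k = (p * q) ^ (k + 1) := by
    induction k with
    | zero => simp
    | succ k ih =>
      rw [pow_succ, ← mul_assoc, ih, pow_succ, mul_assoc, hleft, ← mul_assoc, ← pow_succ, ← pow_succ]
  rw [hpow, pow_succ, mul_assoc, mul_assoc p q q, hq]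

/-- A power of an operator bounds its quadratic form by the power of the norm bound. -/
theorem abs_inner_pow_apply_le {E : Type*} [NormedAddCommGroup E] [InnerProductSpace ℝ E]
    (A : E →L[ℝ] E) {c : ℝ} (hA : ‖A‖ ≤ c) (k : ℕ) (v : E) :
    |⟪v, (A ^ k) v⟫| ≤ c ^ k * ⟪v, v⟫ := by
  have hpow : ‖(A ^ k) v‖ ≤ c ^ k * ‖v‖ := by
    induction k with
    | zero => simp
    | succ k ih =>
      rw [pow_succ', pow_succ', mul_assoc]
      exact A.le_of_opNorm_le_of_le hA ih
  calc |⟪v, (A ^ k) v⟫| ≤ ‖v‖ * ‖(A ^ k) v‖ := abs_real_inner_le_norm _ _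
    _ ≤ ‖v‖ * (c ^ k * ‖v‖) := by gcongr
    _ = c ^ k * ⟪v, v⟫ := by rw [real_inner_self_eq_norm_mul_norm]; ring

/-- Trace bound in the variance analysis of Proposition 3: for orthogonal projections
`P₁, P₂, Q` on a finite-dimensional real inner product space with `Q∘P₁ = Q` and
`‖P₂P₁P₂‖_op ≤ ρ²`, one has `|tr(Q(P₁P₂)^j Q)| ≤ ρ^{2(j−1)} tr(QP₂)` for every `j ≥ 1`. -/
theorem stmt14 {E : Type*} [NormedAddCommGroup E] [InnerProductSpace ℝ E]
    [FiniteDimensional ℝ E]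
    (P₁ P₂ Q : E →L[ℝ] E)
    (hP₁s : ∀ x y : E, ⟪P₁ x, y⟫ = ⟪x, P₁ y⟫) (hP₁i : P₁ ∘L P₁ = P₁)
    (hP₂s : ∀ x y : E, ⟪P₂ x, y⟫ = ⟪x, P₂ y⟫) (hP₂i : P₂ ∘L P₂ = P₂)
    (hQs : ∀ x y : E, ⟪Q x, y⟫ = ⟪x, Q y⟫) (hQi : Q ∘L Q = Q)
    (hQP₁ : Q ∘L P₁ = Q)
    (ρ : ℝ) (hρ0 : 0 ≤ ρ) (hρ1 : ρ ≤ 1)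
    (hop : ‖P₂ ∘L P₁ ∘L P₂‖ ≤ ρ ^ 2)
    (j : ℕ) (hj : 1 ≤ j) :
    |LinearMap.trace ℝ E ((Q ∘L ((P₁ ∘L P₂) ^ j) ∘L Q : E →L[ℝ] E) : E →ₗ[ℝ] E)| ≤
      ρ ^ (2 * (j - 1)) * LinearMap.trace ℝ E ((Q ∘L P₂ : E →L[ℝ] E) : E →ₗ[ℝ] E) := by
  obtain ⟨k, rfl⟩ := Nat.exists_eq_add_of_le' hj
  have hP₂v : ∀ x, P₂ (P₂ x) = P₂ x := fun x => DFunLike.congr_fun hP₂i x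
  have hQP₁v : ∀ x, Q (P₁ x) = Q x := fun x => DFunLike.congr_fun hQP₁ x
  set A := P₂ ∘L P₁ ∘L P₂
  have hfac : (P₁ ∘L P₂) ^ (k + 1) = P₁ ∘L P₂ ∘L (A ^ k) ∘L P₂ :=
    mul_pow_succ_eq_of_mul_self_eq hP₂i k
  have htr : LinearMap.trace ℝ E ((Q ∘L P₂ : E →L[ℝ] E) : E →ₗ[ℝ] E) =
      LinearMap.trace ℝ E ((Q ∘L P₂ ∘L Q : E →L[ℝ] E) : E →ₗ[ℝ] E) := by
    have hcomm := LinearMap.trace_mul_comm ℝ (Q : E →ₗ[ℝ] E) ((P₂ ∘L Q : E →L[ℝ] E) : E →ₗ[ℝ] E)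
    have hcomm' := LinearMap.trace_mul_comm ℝ (Q : E →ₗ[ℝ] E) (P₂ : E →ₗ[ℝ] E)
    have hQQ : ((P₂ ∘L Q : E →L[ℝ] E) : E →ₗ[ℝ] E) * (Q : E →ₗ[ℝ] E) =
        (P₂ : E →ₗ[ℝ] E) * (Q : E →ₗ[ℝ] E) := by
      ext x
      exact congrArg P₂ (DFunLike.congr_fun hQi x)
    rw [hQQ] at hcomm
    exact hcomm'.trans hcomm.symm
  let b := stdOrthonormalBasis ℝ E
  rw [htr, LinearMap.trace_eq_sum_inner _ b, LinearMap.trace_eq_sum_inner _ b, Finset.mul_sum,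
    hfac, Nat.add_sub_cancel, pow_mul]
  refine (Finset.abs_sum_le_sum_abs _ _).trans (Finset.sum_le_sum fun i _ => ?_)
  have hbound := abs_inner_pow_apply_le A hop k (P₂ (Q (b i)))
  have hl : ⟪b i, Q (P₁ (P₂ ((A ^ k) (P₂ (Q (b i))))))⟫ =
      ⟪P₂ (Q (b i)), (A ^ k) (P₂ (Q (b i)))⟫ := by
    rw [hQP₁v, ← hQs, ← hP₂s]
  have hr : ⟪b i, Q (P₂ (Q (b i)))⟫ = ⟪P₂ (Q (b i)), P₂ (Q (b i))⟫ := by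
    rw [← hQs, hP₂s, hP₂v]
  rw [← hl, ← hr] at hbound
  exact hbound
end

section
/- Let V₁ and V₂ be closed subspaces of a real Hilbert space H such that V₁ + V₂ is closed, and let c > 0 be a constant with ‖g₁ + g₂‖² ≥ c‖g₁‖² for all g₁ ∈ V₁ and g₂ ∈ V₂ (in particular V₁ ∩ V₂ = {0}, so elements of V₁ + V₂ have unique decompositions). Let Π_V, Π_{V₁}, Π_{V₂} denote the orthogonal projections onto V₁ + V₂, V₁, V₂, and for h ∈ H write Π_V h = (Π_V h)₁ + (Π_V h)₂ with (Π_V h)_j ∈ V_j. Then for every h ∈ H: (a) ‖Π_{V₁} h − (Π_V h)₁‖² ≤ (1/c) ‖h − Π_{V₁} h‖², and (b) ‖(Π_V h)₁‖² ≤ (1/c) ‖h − Π_{V₂} h‖². -/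
/-- The foot `p` of a perpendicular from `x` to a subspace is at most as far from a point of the
subspace as `x` is. -/
theorem Submodule.norm_sub_sq_le_of_sub_mem_orthogonal {H : Type*} [NormedAddCommGroup H]
    [InnerProductSpace ℝ H] (W : Submodule ℝ H) {x p v : H} (hp : p ∈ W) (hx : x - p ∈ Wᗮ)
    (hv : v ∈ W) : ‖p - v‖ ^ 2 ≤ ‖x - v‖ ^ 2 := by
  have horth : inner ℝ (p - v) (x - p) = 0 := hx _ (W.sub_mem hp hv)
  have hpyth := norm_add_sq_real (p - v) (x - p)
  rw [horth, sub_add_sub_cancel'] at hpyth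
  nlinarith [sq_nonneg ‖x - p‖]

/-- Lemma 10 of the paper (abstract Hilbert-space form). If `c‖g₁‖² ≤ ‖g₁ + g₂‖²` for all
`g₁ ∈ V₁`, `g₂ ∈ V₂`, and `Π_V h = g₁ + g₂` is the unique decomposition of the projection of
`h` onto the closed sumspace `V₁ + V₂`, then
(a) `‖Π_{V₁}h − g₁‖² ≤ (1/c)‖h − Π_{V₁}h‖²` and (b) `‖g₁‖² ≤ (1/c)‖h − Π_{V₂}h‖²`. -/
theorem stmt17 {H : Type*} [NormedAddCommGroup H] [InnerProductSpace ℝ H] [CompleteSpace H]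
    (V₁ V₂ : Submodule ℝ H)
    (hc₁ : IsClosed (V₁ : Set H)) (hc₂ : IsClosed (V₂ : Set H))
    (hcsum : IsClosed ((V₁ ⊔ V₂ : Submodule ℝ H) : Set H))
    (c : ℝ) (hc : 0 < c)
    (hcoer : ∀ g₁ ∈ V₁, ∀ g₂ ∈ V₂, c * ‖g₁‖ ^ 2 ≤ ‖g₁ + g₂‖ ^ 2)
    (P P₁ P₂ : H →L[ℝ] H)
    (hP : ∀ x : H, P x ∈ V₁ ⊔ V₂ ∧ x - P x ∈ (V₁ ⊔ V₂ : Submodule ℝ H)ᗮ)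
    (hP₁ : ∀ x : H, P₁ x ∈ V₁ ∧ x - P₁ x ∈ V₁ᗮ)
    (hP₂ : ∀ x : H, P₂ x ∈ V₂ ∧ x - P₂ x ∈ V₂ᗮ)
    (h g₁ g₂ : H) (hg₁ : g₁ ∈ V₁) (hg₂ : g₂ ∈ V₂) (hdec : P h = g₁ + g₂) :
    ‖P₁ h - g₁‖ ^ 2 ≤ 1 / c * ‖h - P₁ h‖ ^ 2 ∧ ‖g₁‖ ^ 2 ≤ 1 / c * ‖h - P₂ h‖ ^ 2 := by
  have hdist {v : H} (hv : v ∈ V₁ ⊔ V₂) : ‖g₁ + g₂ - v‖ ^ 2 ≤ ‖h - v‖ ^ 2 :=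
    hdec ▸ Submodule.norm_sub_sq_le_of_sub_mem_orthogonal _ (hP h).1 (hP h).2 hv
  rw [one_div_mul_eq_div, one_div_mul_eq_div, le_div_iff₀' hc, le_div_iff₀' hc]
  constructor
  · calc
      c * ‖P₁ h - g₁‖ ^ 2 = c * ‖g₁ - P₁ h‖ ^ 2 := by rw [norm_sub_rev]
      _ ≤ ‖g₁ - P₁ h + g₂‖ ^ 2 := hcoer _ (V₁.sub_mem hg₁ (hP₁ h).1) _ hg₂
      _ = ‖g₁ + g₂ - P₁ h‖ ^ 2 := by rw [sub_add_eq_add_sub]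
      _ ≤ ‖h - P₁ h‖ ^ 2 := hdist (Submodule.mem_sup_left (hP₁ h).1)
  · calc
      c * ‖g₁‖ ^ 2 ≤ ‖g₁ + (g₂ - P₂ h)‖ ^ 2 := hcoer _ hg₁ _ (V₂.sub_mem hg₂ (hP₂ h).1)
      _ = ‖g₁ + g₂ - P₂ h‖ ^ 2 := by rw [add_sub_assoc]
      _ ≤ ‖h - P₂ h‖ ^ 2 := hdist (Submodule.mem_sup_right (hP₂ h).1)
end

section
/- Let E be a finite-dimensional real inner product space, and let P₁, P₂, Q be orthogonal projections on E (self-adjoint idempotent linear maps) such that Q ∘ P₁ = Q (the range of Q is contained in the range of P₁). Let 0 ≤ ρ < 1 be such that the operator norm of P₂P₁P₂ is at most ρ². For an integer k ≥ 1 define the linear map A_k = P₁ − Σ_{j=1}^{k} (P₁P₂)^j (I − P₁), where I is the identity on E. Then tr(Q A_k A_kᵀ Q) ≤ tr(Q) + (1/(1 − ρ²)) tr(Q P₂), where A_kᵀ denotes the adjoint of A_k. -/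
open scoped RealInnerProductSpace

section BackfittingTrace

variable {E : Type*} [NormedAddCommGroup E] [InnerProductSpace ℝ E]

theorem inner_pow_apply_nonneg {M : E →L[ℝ] E} (hMs : ∀ x y : E, ⟪M x, y⟫ = ⟪x, M y⟫)
    (hM : ∀ x : E, 0 ≤ ⟪M x, x⟫) (n : ℕ) (x : E) : 0 ≤ ⟪(M ^ n) x, x⟫ := by
  induction n using Nat.twoStepInduction generalizing x with
  | zero => simp
  | one => simpa using hM x
  | more n ih _ =>
    have h : M ^ (n + 2) = M * M ^ n * M := by rw [pow_succ, pow_succ']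
    rw [h]
    simpa [hMs] using ih (M x)

theorem inner_pow_apply_le {M : E →L[ℝ] E} {r : ℝ} (hM : ‖M‖ ≤ r) (n : ℕ) (x : E) :
    ⟪(M ^ n) x, x⟫ ≤ r ^ n * ‖x‖ ^ 2 := by
  have h : ‖(M ^ n) x‖ ≤ r ^ n * ‖x‖ := by
    induction n with
    | zero => simp
    | succ n ih =>
      rw [pow_succ', pow_succ', mul_assoc]
      exact M.le_of_opNorm_le_of_le hM ih
  calc ⟪(M ^ n) x, x⟫ ≤ ‖(M ^ n) x‖ * ‖x‖ := real_inner_le_norm _ _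
    _ ≤ r ^ n * ‖x‖ * ‖x‖ := by gcongr
    _ = r ^ n * ‖x‖ ^ 2 := by ring

/-- For a positive operator `M` of norm at most `r < 1`, the truncated Neumann series `z` of
`(1 - M)⁻¹ y` satisfies `⟪z, (1 - M) z⟫ ≤ ‖y‖² / (1 - r)`. -/
theorem inner_geom_sum_one_sub_le {M : E →L[ℝ] E} (hMs : ∀ x y : E, ⟪M x, y⟫ = ⟪x, M y⟫)
    (hM : ∀ x : E, 0 ≤ ⟪M x, x⟫) {r : ℝ} (hr0 : 0 ≤ r) (hr1 : r < 1) (hMr : ‖M‖ ≤ r)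
    (k : ℕ) (y : E) :
    ⟪(∑ i ∈ Finset.range k, M ^ i) y, (1 - M) ((∑ i ∈ Finset.range k, M ^ i) y)⟫ ≤
      1 / (1 - r) * ‖y‖ ^ 2 := by
  have hpow : ∀ (n : ℕ) (u v : E), ⟪(M ^ n) u, v⟫ = ⟪u, (M ^ n) v⟫ := by
    intro n
    induction n with
    | zero => simp
    | succ n ih =>
      intro u v
      rw [pow_succ' M n, mul_apply_eq_comp, hMs, ih, ← pow_succ' M n, pow_succ M n,
        mul_apply_eq_comp]
  rw [← mul_apply_eq_comp (1 - M), mul_neg_geom_sum, sum_apply, sum_inner]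
  calc ∑ i ∈ Finset.range k, ⟪(M ^ i) y, (1 - M ^ k) y⟫
      ≤ ∑ i ∈ Finset.range k, r ^ i * ‖y‖ ^ 2 := by
        refine Finset.sum_le_sum fun i _ => ?_
        have h : ⟪(M ^ i) y, (M ^ k) y⟫ = ⟪(M ^ (k + i)) y, y⟫ := by
          rw [pow_add, mul_apply_eq_comp, hpow k]
        have := inner_pow_apply_nonneg hMs hM (k + i) y
        have := inner_pow_apply_le hMr i y
        simp only [sub_apply, one_apply_eq_self, inner_sub_right]
        linarith
    _ = (∑ i ∈ Finset.range k, r ^ i) * ‖y‖ ^ 2 := by rw [Finset.sum_mul]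
    _ ≤ 1 / (1 - r) * ‖y‖ ^ 2 := by
        gcongr
        rw [le_div_iff₀ (by linarith), geom_sum_mul_neg]
        linarith [pow_nonneg hr0 k]

theorem norm_backfitting_adjoint_sq_le {P₁ P₂ : E →L[ℝ] E}
    (hP₁s : ∀ x y : E, ⟪P₁ x, y⟫ = ⟪x, P₁ y⟫) (hP₁i : P₁ * P₁ = P₁)
    (hP₂s : ∀ x y : E, ⟪P₂ x, y⟫ = ⟪x, P₂ y⟫) (hP₂i : P₂ * P₂ = P₂)
    {r : ℝ} (hr0 : 0 ≤ r) (hr1 : r < 1) (hop : ‖P₂ * P₁ * P₂‖ ≤ r) (k : ℕ)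
    {x : E} (hx : P₁ x = x) :
    ‖(P₁ - ∑ j ∈ Finset.Icc 1 k, (1 - P₁) * (P₂ * P₁) ^ j) x‖ ^ 2 ≤
      ‖x‖ ^ 2 + 1 / (1 - r) * ⟪x, P₂ x⟫ := by
  have h₁ (u : E) : P₁ (P₁ u) = P₁ u := DFunLike.congr_fun hP₁i u
  have h₂ (u : E) : P₂ (P₂ u) = P₂ u := DFunLike.congr_fun hP₂i u
  set M := P₂ * P₁ * P₂ with hMdef
  set z := (∑ i ∈ Finset.range k, M ^ i) (P₂ x) with hz
  have hMs (u v : E) : ⟪M u, v⟫ = ⟪u, M v⟫ := by simp [hMdef, hP₁s, hP₂s]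
  have hM (u : E) : 0 ≤ ⟪M u, u⟫ := by
    have : ⟪M u, u⟫ = ⟪P₁ (P₂ u), P₁ (P₂ u)⟫ := by
      rw [hP₁s, h₁, ← hP₁s, ← hP₂s]
      rfl
    rw [this]
    exact real_inner_self_nonneg
  have hcomm : Commute P₂ M := by
    change P₂ * (P₂ * P₁ * P₂) = P₂ * P₁ * P₂ * P₂
    rw [mul_assoc _ P₂ P₂, hP₂i, ← mul_assoc, ← mul_assoc, hP₂i]
  have hpow (i : ℕ) : (P₂ * P₁) ^ (i + 1) = M ^ i * (P₂ * P₁) := by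
    induction i with
    | zero => simp
    | succ i ih =>
      have hstep : P₂ * P₁ * (P₂ * P₁) = M * (P₂ * P₁) := by
        rw [hMdef, mul_assoc _ P₂ (P₂ * P₁), ← mul_assoc P₂ P₂ P₁, hP₂i]
      rw [pow_succ, ih, mul_assoc, hstep, ← mul_assoc, ← pow_succ]
  have hP₂z : P₂ z = z := by
    have hc : Commute P₂ (∑ i ∈ Finset.range k, M ^ i) :=
      Commute.sum_right _ _ _ fun i _ => hcomm.pow_right i
    have := DFunLike.congr_fun hc.eq (P₂ x)
    simpa only [mul_apply_eq_comp, h₂] using this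
  have happ : (P₁ - ∑ j ∈ Finset.Icc 1 k, (1 - P₁) * (P₂ * P₁) ^ j) x = x - (z - P₁ z) := by
    have hsum : ∑ j ∈ Finset.Icc 1 k, (P₂ * P₁) ^ j =
        (∑ i ∈ Finset.range k, M ^ i) * (P₂ * P₁) := by
      rw [Finset.sum_mul, Finset.range_eq_Ico, ← Finset.Ico_add_one_right_eq_Icc,
        ← Finset.sum_Ico_add' _ 0 k 1]
      exact Finset.sum_congr rfl fun i _ => hpow i
    rw [← Finset.mul_sum, hsum]
    simp only [sub_apply, mul_apply_eq_comp, hx,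
      one_apply_eq_self, ← hz]
  have horth : ⟪x, z - P₁ z⟫ = 0 := by
    rw [inner_sub_right, ← hP₁s, hx, sub_self]
  have hnorm : ‖z - P₁ z‖ ^ 2 = ⟪z, (1 - M) z⟫ := by
    have hMz : ⟪z, M z⟫ = ⟪z, P₁ z⟫ := by
      rw [hMdef, mul_apply_eq_comp, mul_apply_eq_comp, ← hP₂s, hP₂z]
    have hPz : ⟪P₁ z, P₁ z⟫ = ⟪z, P₁ z⟫ := by rw [hP₁s, h₁]
    rw [← real_inner_self_eq_norm_sq]
    simp only [sub_apply, one_apply_eq_self, inner_sub_right,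
      inner_sub_left, hMz, hPz, hP₁s z z]
    ring
  have hy : ‖P₂ x‖ ^ 2 = ⟪x, P₂ x⟫ := by
    rw [← real_inner_self_eq_norm_sq, hP₂s, h₂]
  rw [happ, norm_sub_sq_real, horth, hnorm, ← hy]
  linarith [inner_geom_sum_one_sub_le hMs hM hr0 hr1 hop k (P₂ x)]

end BackfittingTrace

/-- The deterministic trace bound underlying Proposition 3 of the paper: for orthogonal
projections `P₁, P₂, Q` on a finite-dimensional real inner product space with `Q∘P₁ = Q` and
`‖P₂P₁P₂‖_op ≤ ρ² < 1`, the backfitting operator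
`A_k = P₁ − Σ_{j=1}^k (P₁P₂)^j (I − P₁)` satisfies
`tr(Q A_k A_kᵀ Q) ≤ tr(Q) + (1/(1 − ρ²)) tr(Q P₂)`. -/
theorem stmt19 {E : Type*} [NormedAddCommGroup E] [InnerProductSpace ℝ E]
    [FiniteDimensional ℝ E]
    (P₁ P₂ Q : E →L[ℝ] E)
    (hP₁s : ∀ x y : E, ⟪P₁ x, y⟫ = ⟪x, P₁ y⟫) (hP₁i : P₁ ∘L P₁ = P₁)
    (hP₂s : ∀ x y : E, ⟪P₂ x, y⟫ = ⟪x, P₂ y⟫) (hP₂i : P₂ ∘L P₂ = P₂)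
    (hQs : ∀ x y : E, ⟪Q x, y⟫ = ⟪x, Q y⟫) (hQi : Q ∘L Q = Q)
    (hQP₁ : Q ∘L P₁ = Q)
    (ρ : ℝ) (hρ0 : 0 ≤ ρ) (hρ1 : ρ < 1)
    (hop : ‖P₂ ∘L P₁ ∘L P₂‖ ≤ ρ ^ 2)
    (k : ℕ) (hk : 1 ≤ k)
    (A : E →L[ℝ] E)
    (hA : A = P₁ - ∑ j ∈ Finset.Icc 1 k, ((P₁ ∘L P₂) ^ j) ∘L (1 - P₁)) :
    LinearMap.trace ℝ E
        ((Q ∘L A ∘L (ContinuousLinearMap.adjoint A) ∘L Q : E →L[ℝ] E) : E →ₗ[ℝ] E) ≤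
      LinearMap.trace ℝ E (Q : E →ₗ[ℝ] E) +
        1 / (1 - ρ ^ 2) *
          LinearMap.trace ℝ E ((Q ∘L P₂ : E →L[ℝ] E) : E →ₗ[ℝ] E) := by
  have hQ (u : E) : Q (Q u) = Q u := DFunLike.congr_fun hQi u
  have hP₁Q (u : E) : P₁ (Q u) = Q u := by
    refine ext_inner_right ℝ fun v => ?_
    rw [hP₁s, hQs, hQs]
    exact congrArg _ (DFunLike.congr_fun hQP₁ v)
  have hadj : ContinuousLinearMap.adjoint A =
      P₁ - ∑ j ∈ Finset.Icc 1 k, (1 - P₁) * (P₂ * P₁) ^ j := by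
    have s₁ : star P₁ = P₁ :=
      ((ContinuousLinearMap.eq_adjoint_iff P₁ P₁).2 hP₁s).symm
    have s₂ : star P₂ = P₂ :=
      ((ContinuousLinearMap.eq_adjoint_iff P₂ P₂).2 hP₂s).symm
    rw [← ContinuousLinearMap.star_eq_adjoint, hA]
    simp only [← ContinuousLinearMap.mul_def, star_sub, star_sum, star_mul, star_pow, star_one,
      s₁, s₂]
  have hop' : ‖P₂ * P₁ * P₂‖ ≤ ρ ^ 2 := hop
  have hρ : ρ ^ 2 < 1 := by nlinarith
  have hcyc : LinearMap.trace ℝ E ((Q ∘L P₂ : E →L[ℝ] E) : E →ₗ[ℝ] E) =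
      LinearMap.trace ℝ E ((Q ∘L P₂ ∘L Q : E →L[ℝ] E) : E →ₗ[ℝ] E) := by
    conv_lhs => rw [← hQi]
    exact LinearMap.trace_mul_comm ℝ (Q : E →ₗ[ℝ] E) ((Q ∘L P₂ : E →L[ℝ] E) : E →ₗ[ℝ] E)
  rw [hcyc]
  let b := stdOrthonormalBasis ℝ E
  simp only [LinearMap.trace_eq_sum_inner _ b]
  rw [Finset.mul_sum, ← Finset.sum_add_distrib]
  refine Finset.sum_le_sum fun i _ => ?_
  have key := norm_backfitting_adjoint_sq_le hP₁s hP₁i hP₂s hP₂i (sq_nonneg ρ) hρ hop' k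
    (hP₁Q (b i))
  rw [← hadj, ← real_inner_self_eq_norm_sq, ← real_inner_self_eq_norm_sq] at key
  rw [ContinuousLinearMap.adjoint_inner_left, hQs, hQs, hQs, hQ] at key
  exact key
end
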